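/- Let G be a connected finite simple graph with distance matrix D, and let W = {W_1, …, W_k} be a partition of V(G) such that each W_i is either a set of pairwise true twins or a set of pairwise false twins. Choose a representative w_i ∈ W_i for each i, and define the k×k quotient matrix Q by: Q_{ij} = |W_j| · d_G(w_i, w_j) for i ≠ j; Q_{ii} = |W_i| − 1 if W_i consists of true twins; and Q_{ii} = 2(|W_i| − 1) if W_i consists of false twins. Then the nullity of D equals the nullity of Q. -/

import Mathlib

open SimpleGraph

/-- The distance matrix of a finite simple graph, over ℚ: the `(u,v)` entry is the
graph distance between `u` and `v`. -/
noncomputable def distMatrix {V : Type*} [Fintype V] (G : SimpleGraph V) : Matrix V V ℚ :=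
  fun u v => (G.dist u v : ℚ)

/-- Two vertices are true twins if their closed neighborhoods coincide. -/
def TrueTwins {V : Type*} (G : SimpleGraph V) (u v : V) : Prop :=
  insert u (G.neighborSet u) = insert v (G.neighborSet v)

/-- Two vertices are false twins if their open neighborhoods coincide. -/
def FalseTwins {V : Type*} (G : SimpleGraph V) (u v : V) : Prop :=
  G.neighborSet u = G.neighborSet v

theorem twin_dist_le {V : Type*} (G : SimpleGraph V) (hG : G.Connected) {u u' v : V}
    (h : ∀ a, G.Adj u a → a = u' ∨ G.Adj u' a) (hv : u ≠ v) : G.dist u' v ≤ G.dist u v := by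
  obtain ⟨p, hp⟩ := hG.exists_walk_length_eq_dist u v
  cases p with
  | nil => exact absurd rfl hv
  | @cons _ a _ hadj q =>
    rw [← hp, SimpleGraph.Walk.length_cons]
    rcases h a hadj with rfl | h'
    · exact (SimpleGraph.dist_le q).trans (Nat.le_succ _)
    · exact SimpleGraph.dist_le (SimpleGraph.Walk.cons h' q)

theorem twins_adj {V : Type*} (G : SimpleGraph V) {b : Bool} {u u' : V}
    (h : if b then TrueTwins G u u' else FalseTwins G u u') :
    ∀ a, G.Adj u a → a = u' ∨ G.Adj u' a := by
  intro a ha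
  cases b
  · have h : G.neighborSet u = G.neighborSet u' := by simpa [FalseTwins] using h
    right
    have : a ∈ G.neighborSet u := ha
    rw [h] at this
    exact this
  · have h : insert u (G.neighborSet u) = insert u' (G.neighborSet u') := by
      simpa [TrueTwins] using h
    have : a ∈ insert u (G.neighborSet u) := Or.inr ha
    rw [h] at this
    exact this

theorem twins_dist {V : Type*} (G : SimpleGraph V) (hG : G.Connected) {b : Bool} {u u' : V}
    (h : if b then TrueTwins G u u' else FalseTwins G u u') (hne : u ≠ u') :
    G.dist u u' = if b then 1 else 2 := by
  cases b
  · have h : G.neighborSet u = G.neighborSet u' := by simpa [FalseTwins] using h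
    have hna : ¬ G.Adj u u' := by
      intro hadj
      have : u' ∈ G.neighborSet u := hadj
      rw [h] at this
      exact G.loopless.irrefl _ this
    obtain ⟨p, hp⟩ := hG.exists_walk_length_eq_dist u u'
    cases p with
    | nil => exact absurd rfl hne
    | @cons _ a _ hadj q =>
      have h2 : a ∈ G.neighborSet u := hadj
      rw [h] at h2
      have h2 : G.Adj u' a := h2
      have h3 : G.dist u u' ≤ 2 := SimpleGraph.dist_le
        (SimpleGraph.Walk.cons hadj (SimpleGraph.Walk.cons h2.symm SimpleGraph.Walk.nil))
      have h4 : G.dist u u' ≠ 0 := (hG.pos_dist_of_ne hne).ne'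
      have h5 : G.dist u u' ≠ 1 := fun h => hna (SimpleGraph.dist_eq_one_iff_adj.mp h)
      simp only [Bool.false_eq_true, if_false]
      omega
  · have h : insert u (G.neighborSet u) = insert u' (G.neighborSet u') := by
      simpa [TrueTwins] using h
    have : u ∈ insert u (G.neighborSet u) := Or.inl rfl
    rw [h] at this
    rcases this with h1 | h1
    · exact absurd h1 hne
    · have h1 : G.Adj u' u := h1
      simpa using SimpleGraph.dist_eq_one_iff_adj.mpr h1.symm

/-- Quotient-matrix lemma: if the vertex set of a connected graph G is partitioned into
sets P 1, …, P k, each consisting of pairwise true twins (when t i = true) or pairwise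
false twins (when t i = false), with representatives w i ∈ P i, and Q is the k × k quotient
matrix with Q i j = |P j| · d(w i, w j) for i ≠ j, Q i i = |P i| − 1 for true-twin classes
and Q i i = 2(|P i| − 1) for false-twin classes, then the nullity of the distance matrix
of G equals the nullity of Q. -/
theorem nullity_eq_nullity_quotient {V : Type*} [Fintype V] (G : SimpleGraph V)
    (hG : G.Connected) {k : ℕ} (P : Fin k → Finset V)
    (hpart : ∀ v : V, ∃! i, v ∈ P i)
    (t : Fin k → Bool)
    (htwins : ∀ i, ∀ u ∈ P i, ∀ v ∈ P i,
      if t i then TrueTwins G u v else FalseTwins G u v)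
    (w : Fin k → V) (hw : ∀ i, w i ∈ P i)
    (Q : Matrix (Fin k) (Fin k) ℚ)
    (hQ : ∀ i j, Q i j =
      if i = j then
        (if t i then ((P i).card : ℚ) - 1 else 2 * (((P i).card : ℚ) - 1))
      else ((P j).card : ℚ) * (G.dist (w i) (w j))) :
    Fintype.card V - (distMatrix G).rank = k - Q.rank := by
  classical
  choose cls hcls huniq using hpart
  simp only at hcls huniq
  have hmem : ∀ v i, v ∈ P i ↔ cls v = i := fun v i =>
    ⟨fun h => (huniq v i h).symm, fun h => h ▸ hcls v⟩
  have hclsw : ∀ i, cls (w i) = i := fun i => (hmem _ _).1 (hw i)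
  have htw : ∀ u v, cls u = cls v →
      if t (cls u) then TrueTwins G u v else FalseTwins G u v := fun u v h =>
    htwins _ u (hcls u) v ((hmem _ _).2 h.symm)
  have hstep : ∀ u u' v, cls u = cls u' → cls u ≠ cls v → G.dist u v = G.dist u' v := by
    intro u u' v h hv
    apply le_antisymm
    · exact twin_dist_le G hG (twins_adj G (htw u' u h.symm)) (by rintro rfl; exact hv h)
    · exact twin_dist_le G hG (twins_adj G (htw u u' h)) (by rintro rfl; exact hv rfl)
  have hdist : ∀ u v, cls u ≠ cls v → G.dist u v = G.dist (w (cls u)) (w (cls v)) := by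
    intro u v h
    rw [hstep u (w (cls u)) v (hclsw _).symm h, SimpleGraph.dist_comm,
      hstep v (w (cls v)) (w (cls u)) (hclsw _).symm (by rw [hclsw]; exact h.symm),
      SimpleGraph.dist_comm]
  let c : Fin k → ℚ := fun i => if t i then 1 else 2
  have hc : ∀ i, c i ≠ 0 := by intro i; simp only [c]; split_ifs <;> norm_num
  let M : Fin k → Fin k → ℚ := fun i j => if i = j then c i else G.dist (w i) (w j)
  have hD : ∀ u v, distMatrix G u v = M (cls u) (cls v) - if u = v then c (cls u) else 0 := by
    intro u v
    simp only [distMatrix, M]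
    by_cases huv : u = v
    · subst huv; simp
    · by_cases h : cls u = cls v
      · rw [twins_dist G hG (htw u v h) huv]
        simp only [if_neg huv, if_pos h, c]
        split_ifs <;> simp
      · rw [hdist u v h]; simp [huv, h]
  have hQ' : ∀ i j, Q i j = (P j).card * M i j - if i = j then c i else 0 := by
    intro i j
    rw [hQ]
    by_cases h : i = j
    · subst h
      simp only [M, c, if_true]
      split_ifs <;> ring
    · simp [M, h]
  have hDx : ∀ (x : V → ℚ) u, (distMatrix G).mulVec x u
      = ∑ v, M (cls u) (cls v) * x v - c (cls u) * x u := by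
    intro x u
    simp [Matrix.mulVec, dotProduct, hD, sub_mul, Finset.sum_sub_distrib]
  have hcomp : ∀ (y : Fin k → ℚ) u,
      (distMatrix G).mulVec (y ∘ cls) u = Q.mulVec y (cls u) := by
    intro y u
    rw [hDx]
    simp only [Matrix.mulVec, dotProduct, hQ', sub_mul, Finset.sum_sub_distrib, ite_mul, zero_mul,
      Finset.sum_ite_eq, Finset.mem_univ, if_true, Function.comp]
    congr 1
    rw [← Finset.sum_fiberwise' Finset.univ cls (fun j => M (cls u) j * y j)]
    refine Finset.sum_congr rfl fun j _ => ?_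
    have : (Finset.univ.filter fun v => cls v = j) = P j := by
      ext v; simp [hmem]
    rw [this, Finset.sum_const, nsmul_eq_mul]
    ring
  let L : (Fin k → ℚ) →ₗ[ℚ] (V → ℚ) := LinearMap.funLeft ℚ ℚ cls
  have hLinj : Function.Injective L :=
    LinearMap.funLeft_injective_of_surjective ℚ ℚ cls fun i => ⟨w i, hclsw i⟩
  have hker : LinearMap.ker (distMatrix G).mulVecLin
      = (LinearMap.ker Q.mulVecLin).map L := by
    ext x
    simp only [LinearMap.mem_ker, Submodule.mem_map, Matrix.mulVecLin_apply]
    constructor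
    · intro hx
      have hx' : x = (fun i => x (w i)) ∘ cls := by
        funext u
        have h1 := hDx x u
        have h2 := hDx x (w (cls u))
        rw [hx, Pi.zero_apply] at h1 h2
        rw [hclsw] at h2
        exact mul_left_cancel₀ (hc (cls u)) (by simp only [Function.comp]; linarith)
      refine ⟨fun i => x (w i), ?_, hx'.symm⟩
      funext i
      have := hcomp (fun i => x (w i)) (w i)
      rw [← hx', hx, hclsw] at this
      exact this.symm
    · rintro ⟨y, hy, rfl⟩
      funext u
      have := hcomp y u
      rw [hy] at this
      exact this
  have hfin : Module.finrank ℚ (LinearMap.ker (distMatrix G).mulVecLin)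
      = Module.finrank ℚ (LinearMap.ker Q.mulVecLin) := by
    rw [hker]
    exact (Submodule.equivMapOfInjective L hLinj _).finrank_eq.symm
  have e1 := LinearMap.finrank_range_add_finrank_ker (distMatrix G).mulVecLin
  have e2 := LinearMap.finrank_range_add_finrank_ker Q.mulVecLin
  rw [Module.finrank_fintype_fun_eq_card] at e1 e2
  rw [Fintype.card_fin] at e2
  unfold Matrix.rank
  omega
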